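/- Let α, β, η, γ be real numbers with (α,β) ≠ (0,0) and (η,γ) ≠ (0,0), and let ρ₁ > 0 be fixed. For ρ₂ ≥ 0 let r*(ρ₂) be the unique nonnegative solution of the CF fixed-point equation and R_cf(ρ₂) the corresponding CF rate. Then as ρ₂ → ∞, r*(ρ₂) → ∞ and R_cf(ρ₂) → R_w(α,β,ρ₁); i.e., the CF rate achieves the first-lag cut value in the limit of large relay power. -/

import Mathlib

/-- The Wyner per-cell sum-rate `R_w(a,b,ρ) = ∫₀¹ log₂(1 + ρ·(b + 2a·cos(2πf))²) df`. -/
noncomputable def Rw (a b ρ : ℝ) : ℝ :=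
  ∫ f in (0:ℝ)..1, Real.logb 2 (1 + ρ * (b + 2 * a * Real.cos (2 * Real.pi * f)) ^ 2)

open Filter Topology

theorem continuous_wyner_channel (a b : ℝ) :
    Continuous fun f : ℝ => b + 2 * a * Real.cos (2 * Real.pi * f) := by
  fun_prop

theorem continuous_wyner_integrand (a b : ℝ) {ρ : ℝ} (hρ : 0 ≤ ρ) :
    Continuous fun f : ℝ =>
      Real.logb 2 (1 + ρ * (b + 2 * a * Real.cos (2 * Real.pi * f)) ^ 2) := by
  refine Continuous.div_const (Continuous.log (by fun_prop) fun f => ?_) _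
  positivity

theorem monotoneOn_Rw (a b : ℝ) : MonotoneOn (Rw a b) (Set.Ici 0) := by
  intro ρ hρ ρ' hρ' h
  have hρ : 0 ≤ ρ := hρ
  refine intervalIntegral.integral_mono zero_le_one
    ((continuous_wyner_integrand a b hρ).intervalIntegrable _ _)
    ((continuous_wyner_integrand a b (Set.mem_Ici.1 hρ')).intervalIntegrable _ _) fun f => ?_
  refine Real.logb_le_logb_of_le one_lt_two (by positivity) ?_
  gcongr

theorem continuousOn_Rw (a b : ℝ) : ContinuousOn (Rw a b) (Set.Ici 0) := by
  have h : Continuous fun ρ : ℝ => Rw a b |ρ| := by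
    refine intervalIntegral.continuous_parametric_intervalIntegral_of_continuous'
      (μ := MeasureTheory.volume)
      (f := fun ρ f => Real.logb 2 (1 + |ρ| * (b + 2 * a * Real.cos (2 * Real.pi * f)) ^ 2))
      ?_ 0 1
    refine Continuous.div_const (Continuous.log (by fun_prop) fun p => ?_) _
    positivity
  exact h.continuousOn.congr fun ρ hρ => by
    simp only [abs_of_nonneg (Set.mem_Ici.1 hρ)]

/-- Concavity of the logarithm, as a chord bound on `[0, M]`. -/
theorem mul_logb_one_add_le {ρ M x : ℝ} (hρ : 0 ≤ ρ) (hM : 0 < M) (hx : 0 ≤ x) (hxM : x ≤ M) :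
    x / M * Real.logb 2 (1 + ρ * M) ≤ Real.logb 2 (1 + ρ * x) := by
  have hpos : 0 < 1 + ρ * M := by positivity
  rw [← Real.logb_rpow_eq_mul_logb_of_pos hpos]
  refine Real.logb_le_logb_of_le one_lt_two (Real.rpow_pos_of_pos hpos _) ?_
  have h := rpow_one_add_le_one_add_mul_self (s := ρ * M) (p := x / M)
    (by linarith [mul_nonneg hρ hM.le]) (by positivity) ((div_le_one hM).2 hxM)
  have e : x / M * (ρ * M) = ρ * x := by field_simp
  rwa [e] at h

theorem integral_wyner_channel_sq_pos {a b : ℝ} (hab : (a, b) ≠ (0, 0)) :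
    0 < ∫ f in (0:ℝ)..1, (b + 2 * a * Real.cos (2 * Real.pi * f)) ^ 2 := by
  refine intervalIntegral.integral_pos zero_lt_one
    ((continuous_wyner_channel a b).pow 2).continuousOn (fun f _ => sq_nonneg _) ?_
  by_contra! h
  have h0 := h 0 (by norm_num)
  have h1 := h (1 / 2) (by norm_num)
  rw [mul_zero, Real.cos_zero] at h0
  rw [show 2 * Real.pi * (1 / 2) = Real.pi by ring, Real.cos_pi] at h1
  have e0 := pow_eq_zero_iff two_ne_zero |>.1 (le_antisymm h0 (sq_nonneg _))
  have e1 := pow_eq_zero_iff two_ne_zero |>.1 (le_antisymm h1 (sq_nonneg _))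
  exact hab (Prod.ext (by dsimp only; linarith) (by dsimp only; linarith))

theorem wyner_channel_sq_le (a b f : ℝ) :
    (b + 2 * a * Real.cos (2 * Real.pi * f)) ^ 2 ≤ (|b| + 2 * |a|) ^ 2 := by
  refine sq_le_sq' ?_ ?_ <;>
  · have h : |2 * a * Real.cos (2 * Real.pi * f)| ≤ 2 * |a| := by
      rw [abs_mul, abs_mul, abs_two]
      exact mul_le_of_le_one_right (by positivity) (Real.abs_cos_le_one _)
    linarith [abs_le.1 h, neg_abs_le b, le_abs_self b, (abs_le.1 h).1, (abs_le.1 h).2]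

theorem tendsto_Rw_atTop {a b : ℝ} (hab : (a, b) ≠ (0, 0)) :
    Tendsto (Rw a b) atTop atTop := by
  set I := ∫ f in (0:ℝ)..1, (b + 2 * a * Real.cos (2 * Real.pi * f)) ^ 2 with hI
  have hIpos : 0 < I := integral_wyner_channel_sq_pos hab
  set M := (|b| + 2 * |a|) ^ 2 with hM
  have hMpos : 0 < M := by
    refine lt_of_lt_of_le hIpos ?_
    have h := intervalIntegral.integral_mono (μ := MeasureTheory.volume) zero_le_one
      (((continuous_wyner_channel a b).pow 2).intervalIntegrable 0 1)
      (continuous_const.intervalIntegrable 0 1) (wyner_channel_sq_le a b)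
    simpa using h
  have hlog : Tendsto (fun ρ : ℝ => I / M * Real.logb 2 (1 + ρ * M)) atTop atTop :=
    ((Real.tendsto_logb_atTop one_lt_two).comp
      (tendsto_atTop_add_const_left _ _ (tendsto_id.atTop_mul_const hMpos))).const_mul_atTop
      (div_pos hIpos hMpos)
  refine tendsto_atTop_mono' _ ?_ hlog
  filter_upwards [eventually_ge_atTop 0] with ρ hρ
  rw [hI, ← intervalIntegral.integral_div, ← intervalIntegral.integral_mul_const]
  refine intervalIntegral.integral_mono zero_le_one
    (Continuous.intervalIntegrable (by fun_prop) _ _)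
    ((continuous_wyner_integrand a b hρ).intervalIntegrable _ _) fun f => ?_
  exact mul_logb_one_add_le hρ hMpos (sq_nonneg _) (wyner_channel_sq_le a b f)

/-- Fix `ρ₁ > 0`, `(α,β) ≠ (0,0)` and `(η,γ) ≠ (0,0)`. If for each `ρ₂ ≥ 0`, `r*(ρ₂)` is
the nonnegative solution of the CF fixed-point equation, then as `ρ₂ → ∞` one has
`r*(ρ₂) → ∞` and `R_cf(ρ₂) → R_w(α,β,ρ₁)`. -/
theorem stmt_7 (α β η γ ρ₁ : ℝ) (hαβ : (α, β) ≠ (0, 0)) (hηγ : (η, γ) ≠ (0, 0))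
    (hρ₁ : 0 < ρ₁) (rstar : ℝ → ℝ)
    (hrs : ∀ ρ₂ : ℝ, 0 ≤ ρ₂ → 0 ≤ rstar ρ₂ ∧
      Rw α β (ρ₁ * (1 - (2:ℝ) ^ (-(rstar ρ₂)))) = Rw η γ ρ₂ - rstar ρ₂) :
    Filter.Tendsto rstar Filter.atTop Filter.atTop ∧
    Filter.Tendsto (fun ρ₂ => Rw α β (ρ₁ * (1 - (2:ℝ) ^ (-(rstar ρ₂)))))
      Filter.atTop (nhds (Rw α β ρ₁)) := by
  have hmem : ∀ r : ℝ, 0 ≤ r → 0 ≤ ρ₁ * (1 - (2:ℝ) ^ (-r)) := fun r hr =>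
    mul_nonneg hρ₁.le (sub_nonneg.2
      (Real.rpow_le_one_of_one_le_of_nonpos one_le_two (neg_nonpos.2 hr)))
  have hr : Tendsto rstar atTop atTop := by
    refine tendsto_atTop_mono' _ ?_
      (tendsto_atTop_add_const_right _ (-Rw α β ρ₁) (tendsto_Rw_atTop hηγ))
    filter_upwards [eventually_ge_atTop 0] with ρ₂ hρ₂
    obtain ⟨h0, heq⟩ := hrs ρ₂ hρ₂
    have hle : ρ₁ * (1 - (2:ℝ) ^ (-(rstar ρ₂))) ≤ ρ₁ :=
      mul_le_of_le_one_right hρ₁.le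
        (sub_le_self _ (Real.rpow_nonneg zero_le_two _))
    have hmono := monotoneOn_Rw α β (hmem _ h0) hρ₁.le hle
    linarith
  refine ⟨hr, ?_⟩
  have hpow : Tendsto (fun ρ₂ => (2:ℝ) ^ (-(rstar ρ₂))) atTop (𝓝 0) :=
    (tendsto_rpow_atBot_of_base_gt_one 2 one_lt_two).comp (tendsto_neg_atTop_atBot.comp hr)
  have harg : Tendsto (fun ρ₂ => ρ₁ * (1 - (2:ℝ) ^ (-(rstar ρ₂)))) atTop (𝓝 ρ₁) := by
    simpa using (hpow.const_sub 1).const_mul ρ₁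
  refine (continuousOn_Rw α β ρ₁ hρ₁.le).tendsto.comp
    (tendsto_nhdsWithin_iff.2 ⟨harg, ?_⟩)
  filter_upwards [eventually_ge_atTop 0] with ρ₂ hρ₂
  exact hmem _ (hrs ρ₂ hρ₂).1
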